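/- arXiv:1503.03367 — 4 statements merged into one kernel-verified Lean document; each statement's English description precedes it below -/
import Mathlib

section
/- Let C ⊆ ℝ^d be a nonempty closed convex set, let P ∈ ℝ^d and r > 0 be such that the closed ball of radius r centered at P is contained in C. Then for every y ∈ ℝ^d one has ⟨y − P, y − proj_C(y)⟩ ≥ r·|y − proj_C(y)|. (This is the quantitative ball-based form of Lemma 3.1(iv) proved by the paper, with γ^{-1} = r depending on the distance from P to the boundary of C.) -/
open scoped RealInnerProductSpace
open Set Metric

/-- Quantitative form of Lemma 3.1(iv): if `C ⊆ ℝ^d` is a nonempty closed convex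
set containing the closed ball of radius `r > 0` centered at `P`, then for every
`y ∈ ℝ^d` one has `⟨y − P, y − proj_C(y)⟩ ≥ r·|y − proj_C(y)|`. Here `proj` is
the metric projection onto `C`, characterized by `proj y ∈ C` and
`dist y (proj y) = infDist y C`. -/
theorem stmt_3 {d : ℕ} {C : Set (EuclideanSpace ℝ (Fin d))}
    (hne : C.Nonempty) (hcl : IsClosed C) (hconv : Convex ℝ C)
    (P : EuclideanSpace ℝ (Fin d)) (r : ℝ) (hr : 0 < r)
    (hball : Metric.closedBall P r ⊆ C)
    (proj : EuclideanSpace ℝ (Fin d) → EuclideanSpace ℝ (Fin d))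
    (hmem : ∀ y, proj y ∈ C)
    (hdist : ∀ y, dist y (proj y) = Metric.infDist y C) :
    ∀ y : EuclideanSpace ℝ (Fin d),
      r * ‖y - proj y‖ ≤ ⟪y - P, y - proj y⟫ := by
  intro y
  set n := y - proj y with hn
  have hmin : ‖y - proj y‖ = ⨅ w : C, ‖y - w‖ := by
    rw [← dist_eq_norm, hdist y, Metric.infDist_eq_iInf]
    simp only [dist_eq_norm]
  have hz : P + (r / ‖n‖) • n ∈ C := by
    apply hball
    rw [mem_closedBall, dist_eq_norm, add_sub_cancel_left, norm_smul, norm_div, norm_norm,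
      Real.norm_of_nonneg hr.le]
    exact mul_le_of_le_div₀ hr.le (norm_nonneg n) le_rfl
  have hle := (norm_eq_iInf_iff_real_inner_le_zero hconv (hmem y)).1 hmin _ hz
  have hdecomp : P + (r / ‖n‖) • n - proj y = n + (r / ‖n‖) • n - (y - P) := by
    rw [hn]
    abel
  rw [← hn, hdecomp, inner_sub_right, inner_add_right, real_inner_smul_right,
    real_inner_self_eq_norm_sq, real_inner_comm] at hle
  have hscale : r / ‖n‖ * ‖n‖ ^ 2 = r * ‖n‖ := by
    rcases eq_or_ne ‖n‖ 0 with h | h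
    · simp [h]
    · field_simp
  linarith [sq_nonneg ‖n‖]
end

section
/- Let (D_t)_{t∈[0,T]} be a time-dependent domain, i.e., each time slice D_t ⊆ ℝ^d is nonempty, open, bounded and convex, and D_{t'} ⊆ D_t whenever 0 ≤ t ≤ t' ≤ T. Then there exist a point P_T ∈ D_T and a constant γ with 1 ≤ γ < ∞ (depending on the distance from P_T to the boundary of D_T) such that for all t ∈ [0,T] and all y ∈ ℝ^d, ⟨y − P_T, y − π(t,y)⟩ ≥ γ^{-1}·|y − π(t,y)|. (Lemma 3.1(iv) of the paper.) -/
open scoped RealInnerProductSpace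
open Set Metric

/-- A point of `closure K` realising the distance from `y` to the convex set `K` satisfies the
variational inequality of the metric projection. -/
theorem inner_sub_nonpos_of_dist_eq_infDist {E : Type*} [NormedAddCommGroup E]
    [InnerProductSpace ℝ E] {K : Set E} (hK : Convex ℝ K) {y p : E} (hp : p ∈ closure K)
    (h : dist y p = Metric.infDist y K) {w : E} (hw : w ∈ closure K) :
    ⟪y - p, w - p⟫ ≤ 0 := by
  refine (norm_eq_iInf_iff_real_inner_le_zero hK.closure hp).1 ?_ w hw
  rw [← dist_eq_norm, h, ← Metric.infDist_closure, Metric.infDist_eq_iInf]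
  simp only [dist_eq_norm]

/-- If `K` contains a closed ball of radius `r` about `P`, then the direction from the projection
`p` of `y` onto `closure K` to `y` points away from `P`, quantitatively in `r`. -/
theorem mul_norm_le_inner_of_closedBall_subset {E : Type*} [NormedAddCommGroup E]
    [InnerProductSpace ℝ E] {K : Set E} (hK : Convex ℝ K) {P y p : E} {r : ℝ} (hr : 0 ≤ r)
    (hball : Metric.closedBall P r ⊆ K) (hp : p ∈ closure K)
    (h : dist y p = Metric.infDist y K) :
    r * ‖y - p‖ ≤ ⟪y - P, y - p⟫ := by
  rcases eq_or_ne (y - p) 0 with h0 | h0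
  · simp [h0]
  have hn : ‖y - p‖ ≠ 0 := norm_ne_zero_iff.2 h0
  have hw : P + (r / ‖y - p‖) • (y - p) ∈ K := hball <| by
    rw [mem_closedBall_iff_norm, add_sub_cancel_left, norm_smul, norm_div, norm_norm,
      div_mul_cancel₀ _ hn, Real.norm_of_nonneg hr]
  have hproj := inner_sub_nonpos_of_dist_eq_infDist hK hp h (subset_closure hw)
  have hsplit : P + (r / ‖y - p‖) • (y - p) - p
      = (r / ‖y - p‖) • (y - p) + (y - p) - (y - P) := by abel
  have hcancel : r / ‖y - p‖ * (‖y - p‖ * ‖y - p‖) = r * ‖y - p‖ := by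
    field_simp
  rw [hsplit, inner_sub_right, inner_add_right, real_inner_smul_right,
    real_inner_self_eq_norm_mul_norm, hcancel, real_inner_comm] at hproj
  nlinarith [mul_self_nonneg ‖y - p‖]

/-- Lemma 3.1(iv): let `(D_t)_{t∈[0,T]}` be a time-dependent domain whose time
slices are nonempty, open, bounded and convex, and which is nonincreasing in
time. Then there exist `P_T ∈ D_T` and a constant `γ ∈ [1,∞)` such that for all
`t ∈ [0,T]` and `y ∈ ℝ^d`, `⟨y − P_T, y − π(t,y)⟩ ≥ γ⁻¹·|y − π(t,y)|`, where
`π(t,·)` is the metric projection onto the closure of the time slice `D_t`. -/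
theorem stmt_4 {d : ℕ} (T : ℝ) (hT : 0 < T)
    (D : ℝ → Set (EuclideanSpace ℝ (Fin d)))
    (hne : ∀ t ∈ Icc (0 : ℝ) T, (D t).Nonempty)
    (hopen : ∀ t ∈ Icc (0 : ℝ) T, IsOpen (D t))
    (hbdd : ∀ t ∈ Icc (0 : ℝ) T, Bornology.IsBounded (D t))
    (hconv : ∀ t ∈ Icc (0 : ℝ) T, Convex ℝ (D t))
    (hmono : ∀ t ∈ Icc (0 : ℝ) T, ∀ t' ∈ Icc (0 : ℝ) T, t ≤ t' → D t' ⊆ D t)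
    (π : ℝ → EuclideanSpace ℝ (Fin d) → EuclideanSpace ℝ (Fin d))
    (hmem : ∀ t ∈ Icc (0 : ℝ) T, ∀ y, π t y ∈ closure (D t))
    (hdist : ∀ t ∈ Icc (0 : ℝ) T, ∀ y,
      dist y (π t y) = Metric.infDist y (D t)) :
    ∃ P ∈ D T, ∃ γ : ℝ, 1 ≤ γ ∧
      ∀ t ∈ Icc (0 : ℝ) T, ∀ y : EuclideanSpace ℝ (Fin d),
        γ⁻¹ * ‖y - π t y‖ ≤ ⟪y - P, y - π t y⟫ := by
  have hTmem : T ∈ Icc (0 : ℝ) T := ⟨hT.le, le_rfl⟩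
  obtain ⟨P, hP⟩ := hne T hTmem
  obtain ⟨r, hr, hball⟩ := Metric.nhds_basis_closedBall.mem_iff.1 ((hopen T hTmem).mem_nhds hP)
  have hr' : 0 < min r 1 := lt_min hr one_pos
  refine ⟨P, hP, (min r 1)⁻¹, (one_le_inv₀ hr').2 (min_le_right _ _), fun t ht y => ?_⟩
  rw [inv_inv]
  exact mul_norm_le_inner_of_closedBall_subset (hconv t ht) hr'.le
    ((Metric.closedBall_subset_closedBall (min_le_left _ _)).trans
      (hball.trans (hmono t ht T hTmem ht.2))) (hmem t ht y) (hdist t ht y)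
end

section
/- There exists a constant c (one may take c = √2) such that the following holds: if ε ∈ (0,1) and C, C' ⊆ ℝ^d are nonempty closed bounded convex sets whose Hausdorff distance is at most ε, then for every y ∈ ℝ^d, (i) |proj_C(y) − proj_{C'}(y)| ≤ c·√(ε² + ε·d(y,C')) and (ii) |proj_C(y) − proj_{C'}(y)| ≤ c·√(ε² + ε·d(y,C)). (Lemma 3.3 of the paper, with C = cl(D_t) and C' = cl(D_{ε,t}) the time slices of the domain and its smooth approximation.) -/
open scoped RealInnerProductSpace
open Set Metric

section ProjectionStability

variable {E : Type*} [NormedAddCommGroup E] [InnerProductSpace ℝ E]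

/-- The variational inequality satisfied by a nearest point of a convex set. -/
lemma inner_sub_nearest_le_zero {K : Set E} (hK : Convex ℝ K) {y p : E} (hp : p ∈ K)
    (hyp : dist y p = infDist y K) {w : E} (hw : w ∈ K) : ⟪y - p, w - p⟫ ≤ 0 := by
  refine (norm_eq_iInf_iff_real_inner_le_zero hK hp).1 ?_ w hw
  rw [← dist_eq_norm, hyp, infDist_eq_iInf]
  simp only [dist_eq_norm]

/-- If `p`, `q` are nearest points to `y` in convex sets `K`, `L`, and each is within `ε` of the
other set, then `‖p - q‖ ^ 2` is at most `ε` times the sum of the distances to `y`. -/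
lemma norm_sub_nearest_sq_le {K L : Set E} (hK : Convex ℝ K) (hL : Convex ℝ L)
    {y p q p' q' : E} {ε : ℝ} (hp : p ∈ K) (hyp : dist y p = infDist y K)
    (hq : q ∈ L) (hyq : dist y q = infDist y L)
    (hp' : p' ∈ L) (hpp' : dist p p' ≤ ε) (hq' : q' ∈ K) (hqq' : dist q q' ≤ ε) :
    ‖p - q‖ ^ 2 ≤ ε * (dist y p + dist y q) := by
  have h₁ := inner_sub_nearest_le_zero hK hp hyp hq'
  have h₂ := inner_sub_nearest_le_zero hL hq hyq hp'
  have h₃ : ⟪y - p, q - q'⟫ ≤ dist y p * ε := by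
    rw [dist_eq_norm] at hqq' ⊢
    exact (real_inner_le_norm _ _).trans (by gcongr)
  have h₄ : ⟪y - q, p - p'⟫ ≤ dist y q * ε := by
    rw [dist_eq_norm] at hpp' ⊢
    exact (real_inner_le_norm _ _).trans (by gcongr)
  have key : ‖p - q‖ ^ 2 = ⟪y - p, q' - p⟫ + ⟪y - q, p' - q⟫
      + ⟪y - p, q - q'⟫ + ⟪y - q, p - p'⟫ := by
    rw [← real_inner_self_eq_norm_sq]
    simp only [inner_sub_left, inner_sub_right]
    ring
  linarith

/-- The same estimate with only the distance from `y` to `L` on the right-hand side. -/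
lemma norm_sub_nearest_le {K L : Set E} (hK : Convex ℝ K) (hL : Convex ℝ L)
    {y p q p' q' : E} {ε : ℝ} (hp : p ∈ K) (hyp : dist y p = infDist y K)
    (hq : q ∈ L) (hyq : dist y q = infDist y L)
    (hp' : p' ∈ L) (hpp' : dist p p' ≤ ε) (hq' : q' ∈ K) (hqq' : dist q q' ≤ ε) :
    ‖p - q‖ ≤ √2 * √(ε ^ 2 + ε * infDist y L) := by
  have hε : 0 ≤ ε := dist_nonneg.trans hpp'
  have h := norm_sub_nearest_sq_le hK hL hp hyp hq hyq hp' hpp' hq' hqq'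
  have hpq : dist y p ≤ dist y q + ε := by
    rw [hyp]
    exact (infDist_le_dist_of_mem hq').trans ((dist_triangle y q q').trans (by gcongr))
  rw [← Real.sqrt_mul zero_le_two, ← hyq]
  apply Real.le_sqrt_of_sq_le
  nlinarith [mul_le_mul_of_nonneg_left hpq hε, sq_nonneg ε]

end ProjectionStability

/-- Lemma 3.3: there is a constant `c` (one may take `c = √2`) such that if
`ε ∈ (0,1)` and `C, C' ⊆ ℝ^d` are nonempty closed bounded convex sets with
Hausdorff distance at most `ε`, then for every `y ∈ ℝ^d`:
(i)  `|proj_C(y) − proj_{C'}(y)| ≤ c·√(ε² + ε·d(y,C'))`, and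
(ii) `|proj_C(y) − proj_{C'}(y)| ≤ c·√(ε² + ε·d(y,C))`.
The projections are characterized as the nearest points in the respective
sets. -/
theorem stmt_5 {d : ℕ} :
    ∃ c : ℝ, ∀ ε : ℝ, 0 < ε → ε < 1 →
      ∀ C C' : Set (EuclideanSpace ℝ (Fin d)),
        C.Nonempty → C'.Nonempty → IsClosed C → IsClosed C' →
        Bornology.IsBounded C → Bornology.IsBounded C' →
        Convex ℝ C → Convex ℝ C' →
        Metric.hausdorffDist C C' ≤ ε →
        ∀ projC projC' : EuclideanSpace ℝ (Fin d) → EuclideanSpace ℝ (Fin d),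
          (∀ y, projC y ∈ C ∧ dist y (projC y) = Metric.infDist y C) →
          (∀ y, projC' y ∈ C' ∧ dist y (projC' y) = Metric.infDist y C') →
          ∀ y : EuclideanSpace ℝ (Fin d),
            ‖projC y - projC' y‖ ≤
              c * Real.sqrt (ε ^ 2 + ε * Metric.infDist y C') ∧
            ‖projC y - projC' y‖ ≤
              c * Real.sqrt (ε ^ 2 + ε * Metric.infDist y C) := by
  refine ⟨√2, fun ε _ _ C C' hC hC' _ _ hb hb' hcv hcv' hh projC projC' hp hp' y ↦ ?_⟩
  have hfin : hausdorffEDist C C' ≠ ⊤ :=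
    hausdorffEDist_ne_top_of_nonempty_of_bounded hC hC' hb hb'
  have h₁ : dist (projC y) (projC' (projC y)) ≤ ε := by
    rw [(hp' _).2]
    exact (infDist_le_hausdorffDist_of_mem (hp y).1 hfin).trans hh
  have h₂ : dist (projC' y) (projC (projC' y)) ≤ ε := by
    rw [(hp _).2]
    rw [hausdorffDist_comm] at hh
    rw [hausdorffEDist_comm] at hfin
    exact (infDist_le_hausdorffDist_of_mem (hp' y).1 hfin).trans hh
  refine ⟨norm_sub_nearest_le hcv hcv' (hp y).1 (hp y).2 (hp' y).1 (hp' y).2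
    (hp' _).1 h₁ (hp _).1 h₂, ?_⟩
  rw [norm_sub_rev]
  exact norm_sub_nearest_le hcv' hcv (hp' y).1 (hp' y).2 (hp y).1 (hp y).2
    (hp _).1 h₂ (hp' _).1 h₁
end

section
/- There exists a constant c such that the following holds: if ε ∈ (0,1) and C, C' ⊆ ℝ^d are nonempty closed bounded convex sets whose Hausdorff distance is at most ε, then for every y ∈ ℝ^d, (i) |proj_C(y) − proj_{C'}(y)| ≤ c·√ε·(1 + d(y,C')), and (ii) if moreover d(y,C') > ε, then |proj_C(y) − proj_{C'}(y)| ≤ c·√ε·√(d(y,C')). (Lemma 3.4 of the paper, with C = cl(D_t) and C' = cl(D_{ε,t}) the time slices of the domain and its smooth approximation.) -/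
open scoped RealInnerProductSpace
open Set Metric

/-- The variational inequality for a nearest point of a convex set. -/
theorem inner_sub_le_zero_of_dist_eq_infDist {E : Type*} [NormedAddCommGroup E]
    [InnerProductSpace ℝ E] {K : Set E} (hK : Convex ℝ K) {y p z : E} (hp : p ∈ K)
    (hd : dist y p = infDist y K) (hz : z ∈ K) : ⟪y - p, z - p⟫ ≤ 0 := by
  refine (norm_eq_iInf_iff_real_inner_le_zero hK hp).1 ?_ z hz
  rw [← dist_eq_norm, hd, infDist_eq_iInf]
  simp only [dist_eq_norm]

/-- If `p` and `q` are the nearest points to `y` in two convex sets, and each of them is within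
`ε` of a point of the other set, then their squared distance is at most
`ε` times the sum of the distances from `y`. -/
theorem norm_sub_sq_le_of_dist_eq_infDist {E : Type*} [NormedAddCommGroup E]
    [InnerProductSpace ℝ E] {K L : Set E} (hK : Convex ℝ K) (hL : Convex ℝ L) {ε : ℝ}
    {y p q p' q' : E} (hp : p ∈ K) (hpd : dist y p = infDist y K)
    (hq : q ∈ L) (hqd : dist y q = infDist y L)
    (hp' : p' ∈ L) (hpp' : dist p p' ≤ ε) (hq' : q' ∈ K) (hqq' : dist q q' ≤ ε) :
    ‖p - q‖ ^ 2 ≤ ε * (dist y p + dist y q) := by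
  have h₁ := inner_sub_le_zero_of_dist_eq_infDist hK hp hpd hq'
  have h₂ := inner_sub_le_zero_of_dist_eq_infDist hL hq hqd hp'
  have h₃ : ⟪y - p, q - q'⟫ ≤ dist y p * ε := by
    rw [dist_eq_norm] at hqq' ⊢
    exact (real_inner_le_norm _ _).trans (by gcongr)
  have h₄ : ⟪y - q, p - p'⟫ ≤ dist y q * ε := by
    rw [dist_eq_norm] at hpp' ⊢
    exact (real_inner_le_norm _ _).trans (by gcongr)
  have h₅ : ‖p - q‖ ^ 2 = ⟪y - p, q' - p⟫ + ⟪y - p, q - q'⟫ +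
      (⟪y - q, p' - q⟫ + ⟪y - q, p - p'⟫) := by
    rw [← inner_add_right, ← inner_add_right, ← real_inner_self_eq_norm_sq]
    simp only [inner_sub_left, inner_sub_right, inner_add_right, real_inner_comm]
    ring
  linarith

/-- Lemma 3.4: there is a constant `c` such that if `ε ∈ (0,1)` and
`C, C' ⊆ ℝ^d` are nonempty closed bounded convex sets with Hausdorff distance
at most `ε`, then for every `y ∈ ℝ^d`:
(i)  `|proj_C(y) − proj_{C'}(y)| ≤ c·√ε·(1 + d(y,C'))`, and
(ii) if `d(y,C') > ε` then `|proj_C(y) − proj_{C'}(y)| ≤ c·√ε·√(d(y,C'))`.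
The projections are characterized as the nearest points in the respective
sets. -/
theorem stmt_6 {d : ℕ} :
    ∃ c : ℝ, ∀ ε : ℝ, 0 < ε → ε < 1 →
      ∀ C C' : Set (EuclideanSpace ℝ (Fin d)),
        C.Nonempty → C'.Nonempty → IsClosed C → IsClosed C' →
        Bornology.IsBounded C → Bornology.IsBounded C' →
        Convex ℝ C → Convex ℝ C' →
        Metric.hausdorffDist C C' ≤ ε →
        ∀ projC projC' : EuclideanSpace ℝ (Fin d) → EuclideanSpace ℝ (Fin d),
          (∀ y, projC y ∈ C ∧ dist y (projC y) = Metric.infDist y C) →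
          (∀ y, projC' y ∈ C' ∧ dist y (projC' y) = Metric.infDist y C') →
          ∀ y : EuclideanSpace ℝ (Fin d),
            ‖projC y - projC' y‖ ≤
              c * Real.sqrt ε * (1 + Metric.infDist y C') ∧
            (Metric.infDist y C' > ε →
              ‖projC y - projC' y‖ ≤
                c * Real.sqrt ε * Real.sqrt (Metric.infDist y C')) := by
  refine ⟨2, fun ε hε hε1 C C' hC hC' _ _ bC bC' cC cC' hH P P' hP hP' y => ?_⟩
  have hfin := hausdorffEDist_ne_top_of_nonempty_of_bounded hC hC' bC bC'
  have hpp' : dist (P y) (P' (P y)) ≤ ε := by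
    rw [(hP' _).2]
    exact (infDist_le_hausdorffDist_of_mem (hP y).1 hfin).trans hH
  have hqq' : dist (P' y) (P (P' y)) ≤ ε := by
    rw [(hP _).2]
    refine (infDist_le_hausdorffDist_of_mem (hP' y).1 ?_).trans ?_
    · rwa [hausdorffEDist_comm]
    · rwa [hausdorffDist_comm]
  have key := norm_sub_sq_le_of_dist_eq_infDist cC cC' (hP y).1 (hP y).2 (hP' y).1 (hP' y).2
    (hP' (P y)).1 hpp' (hP (P' y)).1 hqq'
  have hD : dist y (P y) ≤ infDist y C' + ε := by
    rw [(hP y).2, ← (hP' y).2]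
    exact (infDist_le_dist_of_mem (hP (P' y)).1).trans
      ((dist_triangle _ _ _).trans (by gcongr))
  rw [(hP' y).2] at key
  have hD0 : 0 ≤ infDist y C' := infDist_nonneg
  set D := infDist y C'
  have key' : ‖P y - P' y‖ ^ 2 ≤ ε * (2 * D + ε) :=
    key.trans (mul_le_mul_of_nonneg_left (by linarith) hε.le)
  refine ⟨abs_le_of_sq_le_sq' ?_ (by positivity) |>.2, fun hlt =>
    abs_le_of_sq_le_sq' ?_ (by positivity) |>.2⟩
  · rw [mul_pow, mul_pow, Real.sq_sqrt hε.le]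
    have : ε * (2 * D + ε) ≤ ε * (4 * (1 + D) ^ 2) :=
      mul_le_mul_of_nonneg_left (by nlinarith) hε.le
    linarith
  · rw [mul_pow, mul_pow, Real.sq_sqrt hε.le, Real.sq_sqrt hD0]
    have : ε * (2 * D + ε) ≤ ε * (4 * D) :=
      mul_le_mul_of_nonneg_left (by linarith) hε.le
    linarith
end
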